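/- arXiv:2605.22405 — 9 statements merged into one kernel-verified Lean document; each statement's English description precedes it below -/
import Mathlib

section
/- Let χ : E → H be a crossed module, let x ∈ H, e ∈ E, and let p, q ∈ ℤ be coprime integers. If χ(e) = x^p and x^q • e = e, then x • e = e. (In particular, for the χ-labelings of the standard Heegaard diagram of the lens space L(p,q), the condition e⁻¹ * (x^q • e) = 1 is equivalent to x • e = e.) -/
/-- For a crossed module `χ : E → H` and coprime integers `p, q`, if `χ e = x ^ p` and
`x ^ q • e = e`, then `x • e = e`. -/
theorem crossedModule_lens_fixed {E H : Type*} [Group E] [Group H]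
    [MulDistribMulAction H E] (χ : E →* H)
    (hequiv : ∀ (x : H) (e : E), χ (x • e) = x * χ e * x⁻¹)
    (hpeiffer : ∀ e f : E, χ e • f = e * f * e⁻¹)
    (x : H) (e : E) (p q : ℤ) (hpq : IsCoprime p q)
    (he : χ e = x ^ p) (hq : x ^ q • e = e) :
    x • e = e := by
  have hp : x ^ p ∈ MulAction.stabilizer H e := by
    rw [MulAction.mem_stabilizer_iff, ← he, hpeiffer, mul_inv_cancel_right]
  have hq' : x ^ q ∈ MulAction.stabilizer H e := hq
  obtain ⟨a, b, hab⟩ := hpq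
  have hx : x = (x ^ p) ^ a * (x ^ q) ^ b := by
    rw [← zpow_mul, ← zpow_mul, ← zpow_add, mul_comm p, mul_comm q, hab, zpow_one]
  have hmem : x ∈ MulAction.stabilizer H e := by
    rw [hx]
    exact mul_mem (zpow_mem hp a) (zpow_mem hq' b)
  exact hmem
end

section
/- Let χ : E → H be a crossed module and let p be a natural number. Let x ∈ H and e ∈ E satisfy χ(e) = x^p and x • e = e. Then for every a ∈ H and d ∈ E, the pair x' = a * χ(d) * x * a⁻¹ and e' = a • ((∏_{i=0}^{p-1} (x^i • d)) * e) (the product taken in increasing order of i) again satisfies χ(e') = (x')^p and x' • e' = e'. (That is, the gauge group action preserves the set of χ-labelings of the lens space Heegaard diagram.) -/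
theorem map_prod_range_smul_mul_pow {E H : Type*} [Group E] [Group H]
    [MulDistribMulAction H E] (χ : E →* H)
    (hequiv : ∀ (x : H) (e : E), χ (x • e) = x * χ e * x⁻¹) (x : H) (d : E) (n : ℕ) :
    χ ((List.range n).map fun i => x ^ i • d).prod * x ^ n = (χ d * x) ^ n := by
  induction n with
  | zero => simp
  | succ n ih =>
    rw [List.prod_range_succ, map_mul, hequiv, pow_succ (χ d * x), ← ih, pow_succ x]
    group

theorem mul_smul_prod_range_smul {E H : Type*} [Monoid E] [Monoid H]
    [MulDistribMulAction H E] (x : H) (d : E) (n : ℕ) :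
    d * x • ((List.range n).map fun i => x ^ i • d).prod =
      ((List.range n).map fun i => x ^ i • d).prod * x ^ n • d := by
  induction n with
  | zero => simp
  | succ n ih =>
    rw [List.prod_range_succ, smul_mul', ← mul_assoc, ih, smul_smul, ← pow_succ']

/-- The gauge group action preserves the set of `χ`-labelings of the genus-1 Heegaard
diagram of the lens space `L(p,q)`. -/
theorem crossedModule_gauge_preserves_lens_labelings {E H : Type*} [Group E] [Group H]
    [MulDistribMulAction H E] (χ : E →* H)
    (hequiv : ∀ (x : H) (e : E), χ (x • e) = x * χ e * x⁻¹)
    (hpeiffer : ∀ e f : E, χ e • f = e * f * e⁻¹)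
    (p : ℕ) (x : H) (e : E) (h1 : χ e = x ^ p) (h2 : x • e = e) (a : H) (d : E) :
    χ (a • (((List.range p).map fun i => x ^ i • d).prod * e)) = (a * χ d * x * a⁻¹) ^ p ∧
    (a * χ d * x * a⁻¹) • (a • (((List.range p).map fun i => x ^ i • d).prod * e)) =
      a • (((List.range p).map fun i => x ^ i • d).prod * e) := by
  constructor
  · rw [hequiv, map_mul, h1, map_prod_range_smul_mul_pow χ hequiv, mul_assoc a (χ d) x, conj_pow]
  · have hd : x ^ p • d = e * d * e⁻¹ := by rw [← h1, hpeiffer]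
    rw [smul_smul, inv_mul_cancel_right, mul_assoc, mul_smul, mul_smul, hpeiffer, smul_mul' x, h2,
      ← mul_assoc, mul_smul_prod_range_smul, hd]
    congr 1
    group
end

section
/- Let χ : E → H be a crossed module, let p be a natural number, and consider the gauge group G = H ⋉ E with product (a, d) * (a', d') = (a * a', ((a')⁻¹ • d) * d') and unit (1, 1), acting on pairs by (a, d) · (x, e) = (a * χ(d) * x * a⁻¹, a • ((∏_{i=0}^{p-1} (x^i • d)) * e)). Then for every (x, e) ∈ H × E with χ(e) = x^p and x • e = e: (1, 1) · (x, e) = (x, e), and for all (a, d), (a', d') ∈ G one has ((a, d) * (a', d')) · (x, e) = (a, d) · ((a', d') · (x, e)). (That is, this formula defines a left group action of the gauge group on the set of χ-labelings of the lens space Heegaard diagram.) -/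
/-- The product of the gauge group `H ⋉ E` of the genus-1 Heegaard diagram. -/
def lensGaugeMul {E H : Type*} [Group E] [Group H] [MulDistribMulAction H E]
    (g g' : H × E) : H × E :=
  (g.1 * g'.1, (g'.1⁻¹ • g.2) * g'.2)

/-- The action of the gauge group `H ⋉ E` on pairs `(x, e)`. -/
def lensGaugeAct {E H : Type*} [Group E] [Group H] [MulDistribMulAction H E]
    (χ : E →* H) (p : ℕ) (g : H × E) (q : H × E) : H × E :=
  (g.1 * χ g.2 * q.1 * g.1⁻¹,
    g.1 • ((((List.range p).map fun i => q.1 ^ i • g.2).prod) * q.2))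

/-- In a crossed module, `(χ d * x) ^ n` is `x ^ n` up to the image of the twisted product
`∏ i < n, x ^ i • d`. -/
theorem crossedModule_mul_pow {E H : Type*} [Group E] [Group H] [MulDistribMulAction H E]
    (χ : E →* H) (hequiv : ∀ (x : H) (e : E), χ (x • e) = x * χ e * x⁻¹)
    (x : H) (d : E) (n : ℕ) :
    (χ d * x) ^ n = χ ((List.range n).map fun i => x ^ i • d).prod * x ^ n := by
  induction n with
  | zero => simp
  | succ n ih =>
    rw [pow_succ, ih, List.range_succ, List.map_append, List.prod_append, map_mul,
      List.map_singleton, List.prod_singleton, hequiv, pow_succ]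
    group

/-- The twisted product of `c * d` along `x` splits into the twisted product of `c` along
`χ d * x` and that of `d` along `x`. -/
theorem crossedModule_prod_mul {E H : Type*} [Group E] [Group H] [MulDistribMulAction H E]
    (χ : E →* H) (hequiv : ∀ (x : H) (e : E), χ (x • e) = x * χ e * x⁻¹)
    (hpeiffer : ∀ e f : E, χ e • f = e * f * e⁻¹) (x : H) (c d : E) (n : ℕ) :
    ((List.range n).map fun i => x ^ i • (c * d)).prod =
      ((List.range n).map fun i => (χ d * x) ^ i • c).prod *
        ((List.range n).map fun i => x ^ i • d).prod := by
  induction n with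
  | zero => simp
  | succ n ih =>
    simp only [List.range_succ, List.map_append, List.prod_append, List.map_singleton,
      List.prod_singleton]
    rw [ih, crossedModule_mul_pow χ hequiv, mul_smul, hpeiffer, smul_mul']
    group

/-- The formula for the gauge group action on `χ`-labelings of the lens space Heegaard
diagram defines a left group action: the unit acts trivially and the action is compatible
with the gauge group product. -/
theorem lensGauge_is_action {E H : Type*} [Group E] [Group H]
    [MulDistribMulAction H E] (χ : E →* H)
    (hequiv : ∀ (x : H) (e : E), χ (x • e) = x * χ e * x⁻¹)
    (hpeiffer : ∀ e f : E, χ e • f = e * f * e⁻¹)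
    (p : ℕ) (x : H) (e : E) (h1 : χ e = x ^ p) (h2 : x • e = e) :
    lensGaugeAct χ p ((1 : H), (1 : E)) (x, e) = (x, e) ∧
    ∀ g g' : H × E,
      lensGaugeAct χ p (lensGaugeMul g g') (x, e) =
        lensGaugeAct χ p g (lensGaugeAct χ p g' (x, e)) := by
  refine ⟨by simp [lensGaugeAct], ?_⟩
  rintro ⟨a, d⟩ ⟨a', d'⟩
  simp only [lensGaugeAct, lensGaugeMul, Prod.mk.injEq]
  constructor
  · rw [map_mul, hequiv]
    group
  · have hconj : ∀ i : ℕ, (a' * χ d' * x * a'⁻¹) ^ i • d =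
        a' • ((χ d' * x) ^ i • (a'⁻¹ • d)) := fun i => by
      rw [mul_assoc a', conj_pow, mul_smul, mul_smul]
    have hprod : ((List.range p).map fun i => (a' * χ d' * x * a'⁻¹) ^ i • d).prod =
        a' • ((List.range p).map fun i => (χ d' * x) ^ i • (a'⁻¹ • d)).prod := by
      simp only [hconj, List.smul_prod', List.map_map, Function.comp_def]
    rw [hprod, crossedModule_prod_mul χ hequiv hpeiffer, ← smul_mul', mul_smul, mul_assoc]
end

section
/- Let H be a group acting on a group E by group automorphisms, let S be a type, let α : FreeGroup S →* H be a group homomorphism, and let d : S → E be a map. Then there exists a unique function D : FreeGroup S → E such that D (FreeGroup.of s) = d s for all s ∈ S and D (w * w') = D w * (α w • D w') for all w, w' ∈ FreeGroup S. Moreover, this D satisfies D 1 = 1 and D (w⁻¹) = (α w)⁻¹ • (D w)⁻¹ for all w. (D is called the derivation over α extending d.) -/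
/-- A crossed homomorphism over `α` is the left component of a homomorphism to the
semidirect product whose right component is `α`. -/
def crossedHomToSemidirect {E G H : Type*} [Group E] [Group G] [Group H]
    [MulDistribMulAction H E] (α : G →* H) (D : G → E)
    (hD : ∀ w w' : G, D (w * w') = D w * (α w • D w')) :
    G →* E ⋊[MulDistribMulAction.toMulAut H E] H :=
  MonoidHom.mk' (fun w => ⟨D w, α w⟩) fun w w' => by
    ext <;> simp [hD]

/-- Existence and uniqueness of the derivation over a group homomorphism
`α : FreeGroup S →* H` extending a map `d : S → E`, where `H` acts on `E` by group
automorphisms; moreover the derivation sends `1` to `1` and satisfies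
`D w⁻¹ = (α w)⁻¹ • (D w)⁻¹`. -/
theorem freeGroup_derivation_exists_unique {E H S : Type*} [Group E] [Group H]
    [MulDistribMulAction H E] (α : FreeGroup S →* H) (d : S → E) :
    ∃ D : FreeGroup S → E,
      (∀ s : S, D (FreeGroup.of s) = d s) ∧
      (∀ w w' : FreeGroup S, D (w * w') = D w * (α w • D w')) ∧
      (∀ D' : FreeGroup S → E,
          (∀ s : S, D' (FreeGroup.of s) = d s) →
          (∀ w w' : FreeGroup S, D' (w * w') = D' w * (α w • D' w')) → D' = D) ∧
      D 1 = 1 ∧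
      (∀ w : FreeGroup S, D w⁻¹ = (α w)⁻¹ • (D w)⁻¹) := by
  let F : FreeGroup S →* SemidirectProduct E H (MulDistribMulAction.toMulAut H E) :=
    FreeGroup.lift fun s => ⟨d s, α (FreeGroup.of s)⟩
  have hright : ∀ w, (F w).right = α w := by
    have h : SemidirectProduct.rightHom.comp F = α := by
      ext s
      simp [F]
    exact fun w => DFunLike.congr_fun h w
  refine ⟨fun w => (F w).left, fun s => by simp [F], fun w w' => by simp [hright],
    fun D' hof hmul => ?_, by simp, fun w => by simp [hright]⟩
  have h : crossedHomToSemidirect α D' hmul = F := by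
    ext s <;> simp [F, crossedHomToSemidirect, hof]
  funext w
  exact congrArg SemidirectProduct.left (DFunLike.congr_fun h w)
end

section
/- Let P and H be groups, let υ : P →* H be a group homomorphism, and let H act on P by group automorphisms such that υ(x • m) = x * υ(m) * x⁻¹ for all x ∈ H, m ∈ P. Then the subgroup of P generated by the set of all Peiffer commutators {(υ(m) • n) * m * n⁻¹ * m⁻¹ | m, n ∈ P} is a normal subgroup of P. -/
/-- Conjugating the Peiffer commutator of `m` and `k` by `υ m • n` gives the quotient of the
Peiffer commutators of `m` with `n * k` and of `m` with `n`. -/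
theorem peifferCommutator_conj {P H : Type*} [Group P] [Group H]
    [MulDistribMulAction H P] (υ : P →* H) (m n k : P) :
    (υ m • n) * ((υ m • k) * m * k⁻¹ * m⁻¹) * (υ m • n)⁻¹ =
      ((υ m • (n * k)) * m * (n * k)⁻¹ * m⁻¹) * ((υ m • n) * m * n⁻¹ * m⁻¹)⁻¹ := by
  rw [smul_mul']
  group

/-- Let `υ : P →* H` be equivariant for an action of `H` on `P` by group automorphisms.
Then the subgroup of `P` generated by the Peiffer commutators
`(υ m • n) * m * n⁻¹ * m⁻¹` is normal in `P`. -/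
theorem peifferCommutators_closure_normal {P H : Type*} [Group P] [Group H]
    [MulDistribMulAction H P] (υ : P →* H)
    (hequiv : ∀ (x : H) (m : P), υ (x • m) = x * υ m * x⁻¹) :
    (Subgroup.closure {p : P | ∃ m n : P, p = (υ m • n) * m * n⁻¹ * m⁻¹}).Normal := by
  refine ⟨fun p hp g => ?_⟩
  induction hp using Subgroup.closure_induction with
  | mem p hp =>
    obtain ⟨m, k, rfl⟩ := hp
    obtain ⟨n, rfl⟩ : ∃ n : P, υ m • n = g := ⟨(υ m)⁻¹ • g, smul_inv_smul _ _⟩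
    rw [peifferCommutator_conj]
    exact mul_mem (Subgroup.subset_closure ⟨m, n * k, rfl⟩)
      (inv_mem (Subgroup.subset_closure ⟨m, n, rfl⟩))
  | one => simp
  | mul a b _ _ ha hb => simpa only [conj_mul] using mul_mem ha hb
  | inv a _ ha => simpa only [conj_inv] using inv_mem ha
end

section
/- Fix a natural number p ≥ 1. Define 𝔏 = {(x, n) ∈ ZMod 2 × ZMod 4 | p • x = 0 and (-1)^(x.val) * n = n}, and define a relation on 𝔏 by (x, n) ≈ (x', n') iff x' = x and there exist a ∈ ZMod 2 and d ∈ ZMod 4 with n' = (-1)^(a.val) * (κ_x * d + n), where κ_x = (p : ZMod 4) if x = 0 and κ_x = ((p % 2 : ℕ) : ZMod 4) if x = 1. Then ≈ is an equivalence relation on 𝔏, and the number of its equivalence classes equals 5 if p ≡ 0 (mod 4), equals 4 if p ≡ 2 (mod 4), and equals 1 if p is odd. (These equivalence classes are the gauge orbits of χ-labelings of the lens space L(p,q) for the crossed module χ : ℤ/4ℤ → ℤ/2ℤ, and they enumerate the homotopy classes of maps L(p,q) → Bχ.) -/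
/-- The set of `χ`-labelings of the genus-1 Heegaard diagram of `L(p,q)` for the crossed
module `χ : ℤ/4ℤ → ℤ/2ℤ` (trivial homomorphism, `1 • n = -n`). -/
def lensLabelings (p : ℕ) : Type :=
  {q : ZMod 2 × ZMod 4 // p • q.1 = 0 ∧ (-1 : ZMod 4) ^ q.1.val * q.2 = q.2}

/-- The element `κ_x`: `(p : ℤ/4ℤ)` if `x = 0` and `(p % 2 : ℤ/4ℤ)` if `x = 1`. -/
def lensKappa (p : ℕ) (x : ZMod 2) : ZMod 4 :=
  if x = 0 then (p : ZMod 4) else ((p % 2 : ℕ) : ZMod 4)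

/-- The gauge orbit relation on the `χ`-labelings of `L(p,q)`. -/
def lensRel (p : ℕ) (s t : lensLabelings p) : Prop :=
  t.1.1 = s.1.1 ∧ ∃ a : ZMod 2, ∃ d : ZMod 4,
    t.1.2 = (-1 : ZMod 4) ^ a.val * (lensKappa p s.1.1 * d + s.1.2)

theorem ZMod.neg_one_pow_val_add (a b : ZMod 2) :
    (-1 : ZMod 4) ^ (a + b).val = (-1) ^ a.val * (-1) ^ b.val := by
  revert a b; decide

theorem ZMod.neg_one_pow_val_mul_self (a : ZMod 2) :
    (-1 : ZMod 4) ^ a.val * (-1) ^ a.val = 1 := by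
  revert a; decide

theorem lensRel_equivalence (p : ℕ) : Equivalence (lensRel p) where
  refl s := ⟨rfl, 0, 0, by simp⟩
  symm := by
    rintro s t ⟨hx, a, d, hn⟩
    refine ⟨hx.symm, a, -((-1) ^ a.val * d), ?_⟩
    rw [hx, hn]
    linear_combination (-s.1.2) * ZMod.neg_one_pow_val_mul_self a
  trans := by
    rintro s t u ⟨hx, a, d, hn⟩ ⟨hx', a', d', hn'⟩
    refine ⟨hx'.trans hx, a' + a, (-1) ^ a.val * d' + d, ?_⟩
    rw [hn', hn, hx, ZMod.neg_one_pow_val_add]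
    linear_combination (-(-1) ^ a'.val * lensKappa p s.1.1 * d') *
      ZMod.neg_one_pow_val_mul_self a

theorem lensKappa_mod_four (p : ℕ) : lensKappa (p % 4) = lensKappa p := by
  funext x
  simp [lensKappa, Nat.mod_mod_of_dvd p (show 2 ∣ 4 by decide)]

theorem ZMod.mod_four_nsmul (p : ℕ) (x : ZMod 2) : (p % 4) • x = p • x := by
  have h : (4 : ZMod 2) = 0 := by decide
  conv_rhs => rw [← Nat.mod_add_div p 4]
  simp [h, nsmul_eq_mul]

/-- The labelings depend on `p` only modulo `4`. -/
def lensLabelingsModFour (p : ℕ) : lensLabelings (p % 4) ≃ lensLabelings p :=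
  Equiv.subtypeEquivRight fun q => by rw [ZMod.mod_four_nsmul]

theorem card_quot_lensRel_mod_four (p : ℕ) :
    Nat.card (Quot (lensRel (p % 4))) = Nat.card (Quot (lensRel p)) := by
  refine Nat.card_congr (Quot.congr (lensLabelingsModFour p) fun s t => ?_)
  unfold lensRel
  rw [lensKappa_mod_four]
  rfl

instance (p : ℕ) : Fintype (lensLabelings p) :=
  inferInstanceAs (Fintype {_q : ZMod 2 × ZMod 4 // _})

instance (p : ℕ) : DecidableRel (lensRel p) := fun _ _ =>
  inferInstanceAs (Decidable (_ ∧ _))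

/-- The gauge orbit relation as a setoid. -/
def lensSetoid (p : ℕ) : Setoid (lensLabelings p) := ⟨lensRel p, lensRel_equivalence p⟩

instance (p : ℕ) : Fintype (Quotient (lensSetoid p)) :=
  @Quotient.fintype _ _ (lensSetoid p) (inferInstanceAs (DecidableRel (lensRel p)))

theorem card_quot_lensRel (p : ℕ) :
    Nat.card (Quot (lensRel p)) = Fintype.card (Quotient (lensSetoid p)) :=
  Nat.card_eq_fintype_card (α := Quotient (lensSetoid p))

theorem card_quotient_lensSetoid_of_lt_four : ∀ r < 4, Fintype.card (Quotient (lensSetoid r)) =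
    (if r = 0 then 5 else if r = 2 then 4 else 1) := by
  decide +kernel

/-- The gauge orbit relation on `χ`-labelings of `L(p,q)` (for the crossed module
`ℤ/4ℤ → ℤ/2ℤ`) is an equivalence relation, and the number of equivalence classes is
`5` if `p ≡ 0 (mod 4)`, `4` if `p ≡ 2 (mod 4)`, and `1` if `p` is odd. -/
theorem lensRel_equivalence_card (p : ℕ) (hp : 1 ≤ p) :
    Equivalence (lensRel p) ∧
    Nat.card (Quot (lensRel p)) =
      (if p % 4 = 0 then 5 else if p % 4 = 2 then 4 else 1) := by
  refine ⟨lensRel_equivalence p, ?_⟩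
  rw [← card_quot_lensRel_mod_four, card_quot_lensRel]
  exact card_quotient_lensSetoid_of_lt_four _ (Nat.mod_lt p (by decide))
end

section
/- Let k be a field and A a finite-dimensional Hopf algebra over k whose antipode S is involutory (S ∘ S = id), and assume that the characteristic of k does not divide dim_k A (equivalently, (dim_k A : k) ≠ 0). Then there exists a unique element Λ ∈ A such that Λ * a = ε(a) • Λ and a * Λ = ε(a) • Λ for all a ∈ A, and ε(Λ) = (dim_k A : k). Moreover this Λ satisfies S(Λ) = Λ. -/
open Coalgebra HopfAlgebra TensorProduct

namespace HopfAlgebra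

variable {k A : Type*} [Field k] [Ring A] [HopfAlgebra k A]

/-- The right slice `∑ uᵢ ⊗ vᵢ ↦ ∑ p(vᵢ) uᵢ` by a functional `p`. -/
noncomputable def sliceRight (p : Module.Dual k A) : A ⊗[k] A →ₗ[k] A :=
  TensorProduct.lift ((LinearMap.lsmul k A).flip.compl₂ p)

@[simp]
lemma sliceRight_tmul (p : Module.Dual k A) (u v : A) : sliceRight p (u ⊗ₜ[k] v) = p v • u := rfl

/-- The action `p ⇀ x = p(x₂) x₁` of the dual on a coalgebra, as a linear map in `p`. -/
noncomputable def dualAction : Module.Dual k A →ₗ[k] Module.End k A where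
  toFun p := sliceRight p ∘ₗ comul
  map_add' p q := by
    rw [← LinearMap.add_comp]
    congr 1
    ext u v
    simp [add_smul]
  map_smul' c p := by
    rw [← LinearMap.smul_comp]
    congr 1
    ext u v
    simp [mul_smul]

lemma dualAction_apply (p : Module.Dual k A) (x : A) :
    dualAction p x = sliceRight p (comul x) := rfl

lemma dualAction_counit : dualAction (counit : A →ₗ[k] k) = LinearMap.id := by
  ext x
  simpa [dualAction_apply, ← (ℛ k x).eq, -sum_tmul_counit_eq] using
    congr(TensorProduct.rid k A $(sum_tmul_counit_eq (ℛ k x)))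

lemma sliceRight_tmul_mul (p : Module.Dual k A) (v w : A) (t : A ⊗[k] A) :
    sliceRight p (v ⊗ₜ w * t) = v * sliceRight (p ∘ₗ LinearMap.mulLeft k w) t := by
  induction t using TensorProduct.induction_on <;> simp_all [mul_add]

/-- `p(a -) ⇀ x = S(a₁) (p ⇀ (a₂ x))`. -/
lemma dualAction_comp_mulLeft (p : Module.Dual k A) (a x : A) {ι : Type*} (r : Repr k a ι) :
    dualAction (p ∘ₗ LinearMap.mulLeft k a) x =
      ∑ i ∈ r.index, antipode k (r.left i) * dualAction p (r.right i * x) := by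
  let Φ : A ⊗[k] (A ⊗[k] A) →ₗ[k] A := TensorProduct.lift
    ((LinearMap.mul k A ∘ₗ antipode k).compl₂
      (sliceRight p ∘ₗ LinearMap.mulRight k (comul (R := k) x)))
  have key := congr(Φ $(sum_tmul_tmul_eq r (fun i => ℛ k (r.left i)) (fun i => ℛ k (r.right i))))
  simp only [← TensorProduct.tmul_sum, (ℛ k (r.right _)).eq] at key
  have hcancel (b w : A) : ∑ j ∈ (ℛ k b).index, Φ ((ℛ k b).left j ⊗ₜ ((ℛ k b).right j ⊗ₜ w)) =
      counit (R := k) b • dualAction (p ∘ₗ LinearMap.mulLeft k w) x := by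
    simp only [Φ, TensorProduct.lift.tmul, LinearMap.compl₂_apply, LinearMap.comp_apply,
      LinearMap.mulRight_apply, sliceRight_tmul_mul, LinearMap.mul_apply', ← mul_assoc,
      ← Finset.sum_mul, sum_antipode_mul_eq_smul, smul_mul_assoc, one_mul, dualAction_apply]
  simp only [map_sum, hcancel] at key
  calc
    _ = ∑ i ∈ r.index, counit (R := k) (r.left i) •
          dualAction (p ∘ₗ LinearMap.mulLeft k (r.right i)) x := by
      have hlin : p ∘ₗ LinearMap.mulLeft k a = ∑ i ∈ r.index, counit (R := k) (r.left i) •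
          (p ∘ₗ LinearMap.mulLeft k (r.right i)) := by
        ext y
        conv_lhs => rw [← sum_counit_smul r]
        simp [Finset.sum_mul]
      simp [hlin]
    _ = _ := by
      rw [key]
      simp [Φ, dualAction_apply, Bialgebra.comul_mul]

lemma sum_mul_antipode_swap (hS : ∀ a : A, antipode k (antipode k a) = a) {a : A} {ι : Type*}
    (r : Repr k a ι) :
    ∑ i ∈ r.index, r.right i * antipode k (r.left i) = counit (R := k) a • 1 := by
  simpa [antipode_mul_antidistrib, hS] using congr(antipode k $(sum_mul_antipode_eq_smul r))

lemma trace_dualAction_comp_mulLeft [FiniteDimensional k A]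
    (hS : ∀ a : A, antipode k (antipode k a) = a) (p : Module.Dual k A) (a : A) :
    LinearMap.trace k A (dualAction (p ∘ₗ LinearMap.mulLeft k a)) =
      counit (R := k) a * LinearMap.trace k A (dualAction p) := by
  let r := ℛ k a
  have h : dualAction (p ∘ₗ LinearMap.mulLeft k a) = ∑ i ∈ r.index,
      LinearMap.mulLeft k (antipode k (r.left i)) * (dualAction p * LinearMap.mulLeft k (r.right i))
      := by
    ext x
    simp [dualAction_comp_mulLeft p a x r]
  have h' : ∑ i ∈ r.index, LinearMap.mulLeft k (r.right i) *
      LinearMap.mulLeft k (antipode k (r.left i)) = counit (R := k) a • 1 := by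
    ext x
    simpa [Finset.sum_mul, mul_assoc] using congr($(sum_mul_antipode_swap hS r) * x)
  rw [h, map_sum]
  simp_rw [LinearMap.trace_mul_comm k (LinearMap.mulLeft k (antipode k _)), mul_assoc]
  rw [← map_sum, ← Finset.mul_sum, h']
  simp

/-- The character of the regular representation of the dual, seen as an element of `A`. -/
noncomputable def dualRegularCharacter (k A : Type*) [Field k] [Ring A] [HopfAlgebra k A]
    [FiniteDimensional k A] : A :=
  (Module.evalEquiv k A).symm (LinearMap.trace k A ∘ₗ dualAction)

variable [FiniteDimensional k A]

lemma apply_dualRegularCharacter (p : Module.Dual k A) :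
    p (dualRegularCharacter k A) = LinearMap.trace k A (dualAction p) := by
  simp [dualRegularCharacter]

lemma counit_dualRegularCharacter :
    counit (R := k) (dualRegularCharacter k A) = (Module.finrank k A : k) := by
  rw [apply_dualRegularCharacter, dualAction_counit, LinearMap.trace_id]

lemma mul_dualRegularCharacter (hS : ∀ a : A, antipode k (antipode k a) = a) (a : A) :
    a * dualRegularCharacter k A = counit (R := k) a • dualRegularCharacter k A := by
  rw [← sub_eq_zero, ← Module.forall_dual_apply_eq_zero_iff k]
  intro p
  have h := apply_dualRegularCharacter (p ∘ₗ LinearMap.mulLeft k a)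
  rw [trace_dualAction_comp_mulLeft hS, ← apply_dualRegularCharacter] at h
  simpa [sub_eq_zero] using h

lemma antipode_dualRegularCharacter_mul (hS : ∀ a : A, antipode k (antipode k a) = a) (a : A) :
    antipode k (dualRegularCharacter k A) * a =
      counit (R := k) a • antipode k (dualRegularCharacter k A) := by
  simpa [antipode_mul_antidistrib, hS] using
    congr(antipode k $(mul_dualRegularCharacter hS (antipode k a)))

lemma antipode_dualRegularCharacter (hS : ∀ a : A, antipode k (antipode k a) = a)
    (hdim : (Module.finrank k A : k) ≠ 0) :
    antipode k (dualRegularCharacter k A) = dualRegularCharacter k A := by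
  have h := antipode_dualRegularCharacter_mul hS (dualRegularCharacter k A)
  rw [mul_dualRegularCharacter hS, counit_antipode, counit_dualRegularCharacter] at h
  exact (smul_right_injective A hdim h).symm

end HopfAlgebra

/-- A finite-dimensional involutory Hopf algebra `A` over a field `k` with
`(dim_k A : k) ≠ 0` has a unique two-sided integral element `Λ` with
`ε Λ = dim_k A`, and this `Λ` is invariant under the antipode. -/
theorem involutory_hopf_integral_element (k A : Type*) [Field k] [Ring A]
    [HopfAlgebra k A] [FiniteDimensional k A]
    (hS : ∀ a : A, HopfAlgebra.antipode (R := k) (HopfAlgebra.antipode (R := k) a) = a)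
    (hdim : (Module.finrank k A : k) ≠ 0) :
    ∃ Λ : A,
      ((∀ a : A, Λ * a = Coalgebra.counit (R := k) a • Λ ∧
          a * Λ = Coalgebra.counit (R := k) a • Λ) ∧
        Coalgebra.counit (R := k) Λ = (Module.finrank k A : k)) ∧
      HopfAlgebra.antipode (R := k) Λ = Λ ∧
      ∀ Λ' : A,
        ((∀ a : A, Λ' * a = Coalgebra.counit (R := k) a • Λ' ∧
            a * Λ' = Coalgebra.counit (R := k) a • Λ') ∧
          Coalgebra.counit (R := k) Λ' = (Module.finrank k A : k)) → Λ' = Λ := by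
  have hfix := antipode_dualRegularCharacter hS hdim
  have hright := antipode_dualRegularCharacter_mul hS
  rw [hfix] at hright
  refine ⟨dualRegularCharacter k A, ⟨fun a => ⟨hright a, mul_dualRegularCharacter hS a⟩,
    counit_dualRegularCharacter⟩, hfix, fun Λ' ⟨hΛ', hε⟩ => ?_⟩
  have h := (hΛ' (dualRegularCharacter k A)).1
  rw [mul_dualRegularCharacter hS, hε, counit_dualRegularCharacter] at h
  exact (smul_right_injective A hdim h).symm
end

section
/- Let k be a field and A a finite-dimensional Hopf algebra over k whose antipode S is involutory (S ∘ S = id), and assume (dim_k A : k) ≠ 0. Then there exists a unique k-linear functional λ : A → k such that ((id ⊗ λ) ∘ Δ)(a) = λ(a) • 1_A and ((λ ⊗ id) ∘ Δ)(a) = λ(a) • 1_A for all a ∈ A, and λ(1_A) = (dim_k A : k). Moreover, for the unique two-sided integral element Λ ∈ A with ε(Λ) = (dim_k A : k), one has λ(Λ) = (dim_k A : k). -/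
open scoped TensorProduct

namespace HopfAlgebra

open Coalgebra WithConv

variable {k A : Type*} [Field k] [Ring A] [HopfAlgebra k A]

/-- The left hit action `f ⇀ a = ∑ a₁ f(a₂)` of a functional `f` on `A`. -/
noncomputable def leftHit (f : A →ₗ[k] k) : A →ₗ[k] A :=
  (TensorProduct.rid k A).toLinearMap ∘ₗ f.lTensor A ∘ₗ comul

/-- The right hit action `a ↼ f = ∑ f(a₁) a₂` of a functional `f` on `A`. -/
noncomputable def rightHit (f : A →ₗ[k] k) : A →ₗ[k] A :=
  (TensorProduct.lid k A).toLinearMap ∘ₗ f.rTensor A ∘ₗ comul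

lemma leftHit_apply (f : A →ₗ[k] k) {a : A} {ι : Type*} (r : Repr k a ι) :
    leftHit f a = ∑ i ∈ r.index, f (r.right i) • r.left i := by
  simp [leftHit, ← r.eq]

lemma rightHit_apply (f : A →ₗ[k] k) {a : A} {ι : Type*} (r : Repr k a ι) :
    rightHit f a = ∑ i ∈ r.index, f (r.left i) • r.right i := by
  simp [rightHit, ← r.eq]

lemma leftHit_leftHit (f g : A →ₗ[k] k) (a : A) :
    leftHit f (leftHit g a) = leftHit (toConv f * toConv g).ofConv a := by
  have key : leftHit (toConv f * toConv g).ofConv a =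
      TensorProduct.rid k A ((LinearMap.mul' k k ∘ₗ TensorProduct.map f g).lTensor A
        (comul.lTensor A (comul a))) := by
    simp [leftHit, LinearMap.convMul_def, LinearMap.lTensor_comp]
  rw [key, ← coassoc_apply]
  conv_lhs => rw [leftHit_apply g (ℛ k a)]
  conv_rhs => rw [← (ℛ k a).eq]
  simp only [map_sum, map_smul, LinearMap.rTensor_tmul]
  refine Finset.sum_congr rfl fun i _ ↦ ?_
  rw [leftHit_apply f (ℛ k _), ← (ℛ k ((ℛ k a).left i)).eq]
  simp [TensorProduct.sum_tmul, Finset.smul_sum, smul_smul, mul_comm]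

lemma rightHit_rightHit (f g : A →ₗ[k] k) (a : A) :
    rightHit g (rightHit f a) = rightHit (toConv f * toConv g).ofConv a := by
  have key : rightHit (toConv f * toConv g).ofConv a =
      TensorProduct.lid k A ((LinearMap.mul' k k ∘ₗ TensorProduct.map f g).rTensor A
        (comul.rTensor A (comul a))) := by
    simp [rightHit, LinearMap.convMul_def, LinearMap.rTensor_comp]
  rw [key, ← coassoc_symm_apply]
  conv_lhs => rw [rightHit_apply f (ℛ k a)]
  conv_rhs => rw [← (ℛ k a).eq]
  simp only [map_sum, map_smul, LinearMap.lTensor_tmul]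
  refine Finset.sum_congr rfl fun i _ ↦ ?_
  rw [rightHit_apply g (ℛ k _), ← (ℛ k ((ℛ k a).right i)).eq]
  simp [TensorProduct.tmul_sum, Finset.smul_sum, smul_smul]

lemma comul_eq_includeLeft_mul_includeRight :
    toConv (comul : A →ₗ[k] A ⊗[k] A) =
      toConv (Algebra.TensorProduct.includeLeft : A →ₐ[k] A ⊗[k] A).toLinearMap *
        toConv (Algebra.TensorProduct.includeRight : A →ₐ[k] A ⊗[k] A).toLinearMap := by
  ext a
  simp [(ℛ k a).convMul_apply, (ℛ k a).eq]

lemma comul_mul_includeRight_antipode :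
    toConv (comul : A →ₗ[k] A ⊗[k] A) *
        toConv ((Algebra.TensorProduct.includeRight : A →ₐ[k] A ⊗[k] A).toLinearMap ∘ₗ antipode k) =
      toConv (Algebra.TensorProduct.includeLeft : A →ₐ[k] A ⊗[k] A).toLinearMap := by
  have h := LinearMap.algHom_comp_convMul_distrib
    (Algebra.TensorProduct.includeRight : A →ₐ[k] A ⊗[k] A)
    (toConv LinearMap.id) (toConv (antipode k))
  rw [LinearMap.id_mul_antipode] at h
  rw [comul_eq_includeLeft_mul_includeRight, mul_assoc]
  convert mul_one _
  apply WithConv.ofConv_injective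
  refine h.symm.trans ?_
  ext; simp [LinearMap.convOne_def, Algebra.TensorProduct.tmul_one_eq_one_tmul]

lemma includeLeft_antipode_mul_comul :
    toConv ((Algebra.TensorProduct.includeLeft : A →ₐ[k] A ⊗[k] A).toLinearMap ∘ₗ antipode k) *
        toConv (comul : A →ₗ[k] A ⊗[k] A) =
      toConv (Algebra.TensorProduct.includeRight : A →ₐ[k] A ⊗[k] A).toLinearMap := by
  have h := LinearMap.algHom_comp_convMul_distrib
    (Algebra.TensorProduct.includeLeft : A →ₐ[k] A ⊗[k] A)
    (toConv (antipode k)) (toConv LinearMap.id)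
  rw [LinearMap.antipode_mul_id] at h
  rw [comul_eq_includeLeft_mul_includeRight, ← mul_assoc]
  convert one_mul _
  apply WithConv.ofConv_injective
  refine h.symm.trans ?_
  ext; simp [LinearMap.convOne_def]

lemma sum_comul_mul_antipode {a : A} {ι : Type*} (r : Repr k a ι) :
    ∑ i ∈ r.index, comul (r.left i) * ((1 : A) ⊗ₜ[k] antipode k (r.right i)) = a ⊗ₜ[k] (1 : A) := by
  simpa [r.convMul_apply] using! congr($(comul_mul_includeRight_antipode (k := k) (A := A)) a)

lemma sum_antipode_mul_comul {a : A} {ι : Type*} (r : Repr k a ι) :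
    ∑ i ∈ r.index, (antipode k (r.left i) ⊗ₜ[k] (1 : A)) * comul (r.right i) = (1 : A) ⊗ₜ[k] a := by
  simpa [r.convMul_apply] using! congr($(includeLeft_antipode_mul_comul (k := k) (A := A)) a)

lemma sum_right_mul_antipode_left
    (hS : ∀ a : A, antipode k (antipode k a) = a) {a : A} {ι : Type*} (r : Repr k a ι) :
    ∑ i ∈ r.index, r.right i * antipode k (r.left i) = counit (R := k) a • (1 : A) := by
  simpa [antipode_mul_antidistrib, hS] using congr(antipode k $(sum_mul_antipode_eq_smul r))

lemma sum_antipode_right_mul_left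
    (hS : ∀ a : A, antipode k (antipode k a) = a) {a : A} {ι : Type*} (r : Repr k a ι) :
    ∑ i ∈ r.index, antipode k (r.right i) * r.left i = counit (R := k) a • (1 : A) := by
  simpa [antipode_mul_antidistrib, hS] using congr(antipode k $(sum_antipode_mul_eq_smul r))

lemma leftHit_comp_mulRight (φ : A →ₗ[k] k) (c x : A) :
    leftHit (φ ∘ₗ LinearMap.mulRight k c) x =
      TensorProduct.rid k A (φ.lTensor A (comul x * ((1 : A) ⊗ₜ[k] c))) := by
  rw [leftHit_apply _ (ℛ k x), ← (ℛ k x).eq]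
  simp [Finset.sum_mul]

lemma rightHit_comp_mulLeft (φ : A →ₗ[k] k) (c x : A) :
    rightHit (φ ∘ₗ LinearMap.mulLeft k c) x =
      TensorProduct.lid k A (φ.rTensor A ((c ⊗ₜ[k] (1 : A)) * comul x)) := by
  rw [rightHit_apply _ (ℛ k x), ← (ℛ k x).eq]
  simp [Finset.mul_sum]

lemma antipode_eq_sum_coord {ι : Type*} [Fintype ι] (b : Module.Basis ι k A) (x : A) :
    antipode k x = ∑ j, b.coord j x • antipode k (b j) := by
  conv_lhs => rw [← b.sum_repr x, map_sum]
  simp only [map_smul, Module.Basis.coord_apply]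

lemma leftHit_mul_eq_sum {ι : Type*} [Fintype ι] (b : Module.Basis ι k A)
    (φ : A →ₗ[k] k) (a e : A) :
    leftHit φ a * e = ∑ j, leftHit (φ ∘ₗ LinearMap.mulRight k (antipode k (b j)))
      (a * leftHit (b.coord j) e) := by
  have h : leftHit φ a * e =
      TensorProduct.rid k A (φ.lTensor A (comul a * (e ⊗ₜ[k] (1 : A)))) := by
    rw [leftHit_apply _ (ℛ k a), ← (ℛ k a).eq]
    simp [Finset.sum_mul]
  rw [h, ← sum_comul_mul_antipode (ℛ k e)]
  simp only [leftHit_comp_mulRight, leftHit_apply _ (ℛ k e),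
    antipode_eq_sum_coord b ((ℛ k e).right _), Finset.mul_sum, map_sum,
    TensorProduct.tmul_sum, TensorProduct.tmul_smul, mul_smul_comm,
    map_smul, Bialgebra.comul_mul, mul_assoc]
  exact Finset.sum_comm

lemma mul_rightHit_eq_sum {ι : Type*} [Fintype ι] (b : Module.Basis ι k A)
    (φ : A →ₗ[k] k) (a e : A) :
    e * rightHit φ a = ∑ j, rightHit (φ ∘ₗ LinearMap.mulLeft k (antipode k (b j)))
      (rightHit (b.coord j) e * a) := by
  have h : e * rightHit φ a =
      TensorProduct.lid k A (φ.rTensor A (((1 : A) ⊗ₜ[k] e) * comul a)) := by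
    rw [rightHit_apply _ (ℛ k a), ← (ℛ k a).eq]
    simp [Finset.mul_sum]
  rw [h, ← sum_antipode_mul_comul (ℛ k e)]
  simp only [rightHit_comp_mulLeft, rightHit_apply _ (ℛ k e),
    antipode_eq_sum_coord b ((ℛ k e).left _), Finset.sum_mul, map_sum,
    TensorProduct.sum_tmul, ← TensorProduct.smul_tmul',
    smul_mul_assoc, map_smul, Bialgebra.comul_mul, ← mul_assoc]
  exact Finset.sum_comm

lemma sum_coord_mul_comp_mulRight (hS : ∀ a : A, antipode k (antipode k a) = a)
    {ι : Type*} [Fintype ι] (b : Module.Basis ι k A) (φ : A →ₗ[k] k) :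
    ∑ j, (toConv (b.coord j) *
      toConv (φ ∘ₗ LinearMap.mulRight k (antipode k (b j)))).ofConv = φ 1 • counit := by
  ext x
  have h := congr(φ $(sum_right_mul_antipode_left hS (ℛ k x)))
  simp only [antipode_eq_sum_coord b ((ℛ k x).left _), Finset.mul_sum, map_sum,
    mul_smul_comm, map_smul, smul_eq_mul] at h
  rw [Finset.sum_comm] at h
  rw [LinearMap.sum_apply, LinearMap.smul_apply, smul_eq_mul, mul_comm, ← h]
  exact Finset.sum_congr rfl fun j _ ↦ (ℛ k x).convMul_apply _ _

lemma sum_comp_mulLeft_mul_coord (hS : ∀ a : A, antipode k (antipode k a) = a)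
    {ι : Type*} [Fintype ι] (b : Module.Basis ι k A) (φ : A →ₗ[k] k) :
    ∑ j, (toConv (φ ∘ₗ LinearMap.mulLeft k (antipode k (b j))) *
      toConv (b.coord j)).ofConv = φ 1 • counit := by
  ext x
  have h := congr(φ $(sum_antipode_right_mul_left hS (ℛ k x)))
  simp only [antipode_eq_sum_coord b ((ℛ k x).right _), Finset.sum_mul, map_sum,
    smul_mul_assoc, map_smul, smul_eq_mul] at h
  rw [Finset.sum_comm] at h
  rw [LinearMap.sum_apply, LinearMap.smul_apply, smul_eq_mul, mul_comm, ← h]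
  refine Finset.sum_congr rfl fun j _ ↦ ((ℛ k x).convMul_apply _ _).trans ?_
  exact Finset.sum_congr rfl fun i _ ↦ mul_comm _ _

lemma sum_leftHit_apply {ι : Type*} (s : Finset ι) (f : ι → A →ₗ[k] k) (a : A) :
    ∑ j ∈ s, leftHit (f j) a = leftHit (∑ j ∈ s, f j) a := by
  simp only [leftHit_apply _ (ℛ k a), LinearMap.sum_apply, Finset.sum_smul]
  exact Finset.sum_comm

lemma sum_rightHit_apply {ι : Type*} (s : Finset ι) (f : ι → A →ₗ[k] k) (a : A) :
    ∑ j ∈ s, rightHit (f j) a = rightHit (∑ j ∈ s, f j) a := by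
  simp only [rightHit_apply _ (ℛ k a), LinearMap.sum_apply, Finset.sum_smul]
  exact Finset.sum_comm

lemma leftHit_smul_counit (c : k) (a : A) : leftHit (c • counit : A →ₗ[k] k) a = c • a := by
  simp [leftHit, LinearMap.lTensor_smul]

lemma rightHit_smul_counit (c : k) (a : A) : rightHit (c • counit : A →ₗ[k] k) a = c • a := by
  simp [rightHit, LinearMap.rTensor_smul]

lemma apply_leftHit (f g : A →ₗ[k] k) (a : A) : f (leftHit g a) = g (rightHit f a) := by
  simp [leftHit_apply _ (ℛ k a), rightHit_apply _ (ℛ k a), mul_comm]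

lemma eq_of_rightHit_of_leftHit {f g : A →ₗ[k] k} (hf : ∀ a, rightHit f a = f a • 1)
    (hg : ∀ a, leftHit g a = g a • 1) (h : f 1 = g 1) (h0 : g 1 ≠ 0) : f = g := by
  ext a
  have := apply_leftHit f g a
  rw [hf, hg, map_smul, map_smul, h, smul_eq_mul, smul_eq_mul] at this
  exact (mul_right_cancel₀ h0 this).symm

variable [FiniteDimensional k A]

lemma trace_mulLeft_leftHit (hS : ∀ a : A, antipode k (antipode k a) = a)
    (φ : A →ₗ[k] k) (a : A) :
    LinearMap.trace k A (LinearMap.mulLeft k (leftHit φ a)) =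
      φ 1 * LinearMap.trace k A (LinearMap.mulLeft k a) := by
  let b := Module.finBasis k A
  let Q (j) := leftHit (φ ∘ₗ LinearMap.mulRight k (antipode k (b j))) ∘ₗ LinearMap.mulLeft k a
  have h₁ : LinearMap.mulLeft k (leftHit φ a) = ∑ j, Q j * leftHit (b.coord j) := by
    ext e
    simp [Q, leftHit_mul_eq_sum b]
  have h₂ : ∑ j, leftHit (b.coord j) * Q j = φ 1 • LinearMap.mulLeft k a := by
    ext x
    simp [Q, leftHit_leftHit, sum_leftHit_apply, sum_coord_mul_comp_mulRight hS,
      leftHit_smul_counit]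
  rw [h₁, map_sum]
  simp_rw [LinearMap.trace_mul_comm k (Q _)]
  rw [← map_sum, h₂, map_smul, smul_eq_mul]

lemma trace_mulRight_rightHit (hS : ∀ a : A, antipode k (antipode k a) = a)
    (φ : A →ₗ[k] k) (a : A) :
    LinearMap.trace k A (LinearMap.mulRight k (rightHit φ a)) =
      φ 1 * LinearMap.trace k A (LinearMap.mulRight k a) := by
  let b := Module.finBasis k A
  let Q (j) := rightHit (φ ∘ₗ LinearMap.mulLeft k (antipode k (b j))) ∘ₗ LinearMap.mulRight k a
  have h₁ : LinearMap.mulRight k (rightHit φ a) = ∑ j, Q j * rightHit (b.coord j) := by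
    ext e
    simp [Q, mul_rightHit_eq_sum b]
  have h₂ : ∑ j, rightHit (b.coord j) * Q j = φ 1 • LinearMap.mulRight k a := by
    ext x
    simp [Q, rightHit_rightHit, sum_rightHit_apply, sum_comp_mulLeft_mul_coord hS,
      rightHit_smul_counit]
  rw [h₁, map_sum]
  simp_rw [LinearMap.trace_mul_comm k (Q _)]
  rw [← map_sum, h₂, map_smul, smul_eq_mul]

/-- The trace of left multiplication, as a functional. -/
noncomputable def traceMulLeft (k A : Type*) [Field k] [Ring A] [HopfAlgebra k A] : A →ₗ[k] k :=
  LinearMap.trace k A ∘ₗ LinearMap.mul k A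

/-- The trace of right multiplication, as a functional. -/
noncomputable def traceMulRight (k A : Type*) [Field k] [Ring A] [HopfAlgebra k A] : A →ₗ[k] k :=
  LinearMap.trace k A ∘ₗ (LinearMap.mul k A).flip

lemma rightHit_traceMulLeft (hS : ∀ a : A, antipode k (antipode k a) = a) (a : A) :
    rightHit (traceMulLeft k A) a = traceMulLeft k A a • 1 := by
  rw [← sub_eq_zero, ← Module.forall_dual_apply_eq_zero_iff k]
  intro φ
  rw [map_sub, ← apply_leftHit, map_smul, sub_eq_zero, smul_eq_mul, mul_comm]
  exact trace_mulLeft_leftHit hS φ a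

lemma leftHit_traceMulRight (hS : ∀ a : A, antipode k (antipode k a) = a) (a : A) :
    leftHit (traceMulRight k A) a = traceMulRight k A a • 1 := by
  rw [← sub_eq_zero, ← Module.forall_dual_apply_eq_zero_iff k]
  intro φ
  rw [map_sub, apply_leftHit, map_smul, sub_eq_zero, smul_eq_mul, mul_comm]
  exact trace_mulRight_rightHit hS φ a

lemma traceMulLeft_one : traceMulLeft k A 1 = Module.finrank k A := by
  have : LinearMap.mul k A 1 = LinearMap.id := by ext; simp
  simp [traceMulLeft, this]

lemma traceMulRight_one : traceMulRight k A 1 = Module.finrank k A := by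
  have : (LinearMap.mul k A).flip 1 = LinearMap.id := by ext; simp
  simp [traceMulRight, this]

lemma traceMulLeft_of_mul_eq_counit_smul {Λ : A} (h : ∀ a, Λ * a = counit (R := k) a • Λ) :
    traceMulLeft k A Λ = counit Λ := by
  have : LinearMap.mul k A Λ = (counit (R := k) (A := A)).smulRight Λ := by
    ext a; simp [h]
  simp [traceMulLeft, this, LinearMap.trace_smulRight]

end HopfAlgebra

/-- A finite-dimensional involutory Hopf algebra `A` over a field `k` with
`(dim_k A : k) ≠ 0` has a unique two-sided integral functional `λ` with
`λ 1 = dim_k A`; moreover `λ Λ = dim_k A` for the (unique) two-sided integral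
element `Λ` with `ε Λ = dim_k A`. -/
theorem involutory_hopf_integral_functional (k A : Type*) [Field k] [Ring A]
    [HopfAlgebra k A] [FiniteDimensional k A]
    (hS : ∀ a : A, HopfAlgebra.antipode (R := k) (HopfAlgebra.antipode (R := k) a) = a)
    (hdim : (Module.finrank k A : k) ≠ 0) :
    ∃ lam : A →ₗ[k] k,
      (∀ a : A,
        (TensorProduct.rid k A) ((TensorProduct.map LinearMap.id lam)
          (Coalgebra.comul (R := k) a)) = lam a • (1 : A) ∧
        (TensorProduct.lid k A) ((TensorProduct.map lam LinearMap.id)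
          (Coalgebra.comul (R := k) a)) = lam a • (1 : A)) ∧
      lam 1 = (Module.finrank k A : k) ∧
      (∀ lam' : A →ₗ[k] k,
        (∀ a : A,
          (TensorProduct.rid k A) ((TensorProduct.map LinearMap.id lam')
            (Coalgebra.comul (R := k) a)) = lam' a • (1 : A) ∧
          (TensorProduct.lid k A) ((TensorProduct.map lam' LinearMap.id)
            (Coalgebra.comul (R := k) a)) = lam' a • (1 : A)) →
        lam' 1 = (Module.finrank k A : k) → lam' = lam) ∧
      (∀ Λ : A,
        ((∀ a : A, Λ * a = Coalgebra.counit (R := k) a • Λ ∧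
            a * Λ = Coalgebra.counit (R := k) a • Λ) ∧
          Coalgebra.counit (R := k) Λ = (Module.finrank k A : k)) →
        lam Λ = (Module.finrank k A : k)) := by
  have hR := HopfAlgebra.rightHit_traceMulLeft hS
  have hL (a : A) : HopfAlgebra.leftHit (HopfAlgebra.traceMulLeft k A) a =
      HopfAlgebra.traceMulLeft k A a • 1 := by
    rw [HopfAlgebra.eq_of_rightHit_of_leftHit hR (HopfAlgebra.leftHit_traceMulRight hS)
      (by rw [HopfAlgebra.traceMulLeft_one, HopfAlgebra.traceMulRight_one])
      (by rwa [HopfAlgebra.traceMulRight_one])]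
    exact HopfAlgebra.leftHit_traceMulRight hS a
  refine ⟨HopfAlgebra.traceMulLeft k A, fun a ↦ ⟨hL a, hR a⟩, HopfAlgebra.traceMulLeft_one, ?_, ?_⟩
  · intro lam' h h1
    exact HopfAlgebra.eq_of_rightHit_of_leftHit (fun a ↦ (h a).2) hL
      (by rw [h1, HopfAlgebra.traceMulLeft_one]) (by rwa [HopfAlgebra.traceMulLeft_one])
  · rintro Λ ⟨h, hΛ⟩
    rw [HopfAlgebra.traceMulLeft_of_mul_eq_counit_smul fun a ↦ (h a).1, hΛ]
end

section
/- Let χ : E → H be a crossed module, let B be a type, I an index type, and U : I → Set B a family of subsets. Define a χ-valued Čech cocycle subordinate to U to be a pair of families x = (x_{ij} : (U i ∩ U j) → H) and e = (e_{ijk} : (U i ∩ U j ∩ U k) → E) such that χ(e_{ijk}(v)) * x_{ij}(v) * x_{jk}(v) = x_{ik}(v) for every v ∈ U i ∩ U j ∩ U k, and e_{ikl}(w) * e_{ijk}(w) = e_{ijl}(w) * (x_{ij}(w) • e_{jkl}(w)) for every w ∈ U i ∩ U j ∩ U k ∩ U l. Say two such cocycles (x, e) and (x', e') are cohomologous if there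 exist families a = (a_i : U i → H) and d = (d_{ij} : (U i ∩ U j) → E) such that x'_{ij}(v) = a_i(v) * χ(d_{ij}(v)) * x_{ij}(v) * (a_j(v))⁻¹ for every v ∈ U i ∩ U j, and e'_{ijk}(w) = a_i(w) • (d_{ik}(w) * e_{ijk}(w) * (x_{ij}(w) • (d_{jk}(w))⁻¹) * (d_{ij}(w))⁻¹) for every w ∈ U i ∩ U j ∩ U k. Then 'being cohomologous' is an equivalence relation (reflexive, symmetric, and transitive) on the set of χ-valued Čech cocycles subordinate to U. -/
/-- A `χ`-valued Čech cocycle subordinate to a family of subsets `U : I → Set B`, for a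
crossed module `χ : E → H`: families `x_{ij} : B → H` and `e_{ijk} : B → E` satisfying the
cocycle conditions on the corresponding intersections. -/
def IsCechCocycle {E H B I : Type*} [Group E] [Group H] [MulDistribMulAction H E]
    (χ : E →* H) (U : I → Set B)
    (c : (I → I → B → H) × (I → I → I → B → E)) : Prop :=
  (∀ i j k : I, ∀ v ∈ U i ∩ U j ∩ U k,
      χ (c.2 i j k v) * c.1 i j v * c.1 j k v = c.1 i k v) ∧
  (∀ i j k l : I, ∀ w ∈ U i ∩ U j ∩ U k ∩ U l,
      c.2 i k l w * c.2 i j k w = c.2 i j l w * (c.1 i j w • c.2 j k l w))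

/-- Two `χ`-valued Čech cocycles are cohomologous if they are related by families
`a_i : B → H` and `d_{ij} : B → E` on the corresponding intersections. -/
def CechCohomologous {E H B I : Type*} [Group E] [Group H] [MulDistribMulAction H E]
    (χ : E →* H) (U : I → Set B)
    (c c' : (I → I → B → H) × (I → I → I → B → E)) : Prop :=
  ∃ a : I → B → H, ∃ d : I → I → B → E,
    (∀ i j : I, ∀ v ∈ U i ∩ U j,
        c'.1 i j v = a i v * χ (d i j v) * c.1 i j v * (a j v)⁻¹) ∧
    (∀ i j k : I, ∀ w ∈ U i ∩ U j ∩ U k,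
        c'.2 i j k w =
          a i w • (d i k w * c.2 i j k w * (c.1 i j w • (d j k w)⁻¹) * (d i j w)⁻¹))

/-- Being cohomologous is an equivalence relation on the set of `χ`-valued Čech cocycles
subordinate to `U`. -/
theorem cechCohomologous_equivalence {E H B I : Type*} [Group E] [Group H]
    [MulDistribMulAction H E] (χ : E →* H)
    (hequiv : ∀ (x : H) (e : E), χ (x • e) = x * χ e * x⁻¹)
    (hpeiffer : ∀ e f : E, χ e • f = e * f * e⁻¹)
    (U : I → Set B) :
    Equivalence (fun (c c' : {c : (I → I → B → H) × (I → I → I → B → E) //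
        IsCechCocycle χ U c}) => CechCohomologous χ U c.1 c'.1) := by
  refine ⟨fun c => ⟨1, 1, by simp, by simp⟩, ?_, ?_⟩
  · rintro ⟨⟨x, e⟩, _⟩ ⟨⟨x', e'⟩, _⟩ ⟨a, d, hx, he⟩
    refine ⟨fun i v => (a i v)⁻¹, fun i j v => a i v • (d i j v)⁻¹, fun i j v hv => ?_,
      fun i j k w hw => ?_⟩
    · simp only at hx ⊢
      rw [hx i j v hv, hequiv, map_inv]
      group
    · simp only at hx he ⊢
      rw [hx i j w hw.1, he i j k w hw]
      simp only [smul_mul', smul_inv', mul_smul, inv_smul_smul, hpeiffer]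
      group
  · rintro ⟨⟨x, e⟩, _⟩ ⟨⟨x', e'⟩, _⟩ ⟨⟨x'', e''⟩, _⟩ ⟨a, d, hx, he⟩ ⟨a', d', hx', he'⟩
    refine ⟨fun i v => a' i v * a i v, fun i j v => ((a i v)⁻¹ • d' i j v) * d i j v,
      fun i j v hv => ?_, fun i j k w hw => ?_⟩
    · simp only at hx hx' ⊢
      rw [hx' i j v hv, hx i j v hv, map_mul, hequiv]
      group
    · simp only at hx he he' ⊢
      rw [he' i j k w hw, he i j k w hw, hx i j w hw.1]
      simp only [smul_mul', smul_inv', mul_smul, smul_inv_smul, hpeiffer, mul_inv_rev]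
      group
end
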